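/- If T is an ergodic Markov operator (fix T = ℂ·1) on a von Neumann algebra A, then every superharmonic projection p with 0 ≠ p ≠ 1 is transient; in fact p itself is a potential. -/

import Mathlib

open Filter Topology ContinuousLinearMap

namespace QMP

variable {H : Type*} [NormedAddCommGroup H] [InnerProductSpace ℂ H] [CompleteSpace H]

/-- `T` is a (quantum) Markov operator on the von Neumann algebra `A`:
a normal, unital, completely positive linear map leaving `A` invariant. -/
structure IsMarkov (A : VonNeumannAlgebra H) (T : (H →L[ℂ] H) → (H →L[ℂ] H)) : Prop where
  linear : IsLinearMap ℂ T
  mapsSelf : ∀ x ∈ A, T x ∈ A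
  unital : T 1 = 1
  cp : ∀ (n : ℕ) (a b : Fin n → (H →L[ℂ] H)),
    0 ≤ ∑ i : Fin n, ∑ j : Fin n, star (b i) * T (star (a i) * a j) * b j
  normal : ∀ {ι : Type} [Preorder ι] [IsDirected ι (· ≤ ·)] (f : ι → (H →L[ℂ] H))
    (y : H →L[ℂ] H), Monotone f → IsLUB (Set.range f) y →
      IsLUB (Set.range fun i => T (f i)) (T y)

/-- `y = ∑ₙ Tⁿ x` with convergence in the strong operator topology. -/
def SOTSum (T : (H →L[ℂ] H) → (H →L[ℂ] H)) (x y : H →L[ℂ] H) : Prop :=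
  ∀ η : H, Tendsto (fun N => ∑ n ∈ Finset.range N, (T^[n] x) η) atTop (𝓝 (y η))

/-- `x ∈ A₊` is `T`-summable: `∑ₙ Tⁿ x` converges strongly to an element of `A₊`. -/
def TSummable (A : VonNeumannAlgebra H) (T : (H →L[ℂ] H) → (H →L[ℂ] H))
    (x : H →L[ℂ] H) : Prop :=
  x ∈ A ∧ 0 ≤ x ∧ ∃ y, y ∈ A ∧ 0 ≤ y ∧ SOTSum T x y

/-- `y` is a potential for `T`: `y = ∑ₙ Tⁿ x` for some `x ∈ A₊`. -/
def IsPotential (A : VonNeumannAlgebra H) (T : (H →L[ℂ] H) → (H →L[ℂ] H))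
    (y : H →L[ℂ] H) : Prop :=
  y ∈ A ∧ 0 ≤ y ∧ ∃ x, x ∈ A ∧ 0 ≤ x ∧ SOTSum T x y

/-- `p` is an orthogonal projection belonging to `A`. -/
def IsProj (A : VonNeumannAlgebra H) (p : H →L[ℂ] H) : Prop :=
  p ∈ A ∧ IsSelfAdjoint p ∧ IsIdempotentElem p

/-- `p` is the support projection of the self-adjoint element `a`. -/
def IsSupport (A : VonNeumannAlgebra H) (a p : H →L[ℂ] H) : Prop :=
  IsProj A p ∧ a = p * a * p ∧ ∀ q, IsProj A q → a = q * a * q → p ≤ q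

/-- `s` is the supremum of the family of projections `q` in the projection lattice of `A`. -/
def IsProjSup (A : VonNeumannAlgebra H) {ι : Type*} (q : ι → (H →L[ℂ] H))
    (s : H →L[ℂ] H) : Prop :=
  IsProj A s ∧ (∀ i, q i ≤ s) ∧ ∀ r, IsProj A r → (∀ i, q i ≤ r) → s ≤ r

end QMP

namespace QMP

variable {H : Type*} [NormedAddCommGroup H] [InnerProductSpace ℂ H] [CompleteSpace H]

/-- `p` is a transient projection for `T`: it is dominated by the supremum of a family of
`T`-summable projections. -/
def Transient (A : VonNeumannAlgebra H) (T : (H →L[ℂ] H) → (H →L[ℂ] H))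
    (p : H →L[ℂ] H) : Prop :=
  ∃ (ι : Type) (q : ι → (H →L[ℂ] H)) (s : H →L[ℂ] H),
    (∀ i, IsProj A (q i) ∧ TSummable A T (q i)) ∧ IsProjSup A q s ∧ p ≤ s

/-- `e` is the maximal transient projection `p_Tr`: the supremum of all transient
projections of `A`. -/
def IsMaxTransient (A : VonNeumannAlgebra H) (T : (H →L[ℂ] H) → (H →L[ℂ] H))
    (e : H →L[ℂ] H) : Prop :=
  IsProj A e ∧ (∀ p, IsProj A p → Transient A T p → p ≤ e) ∧
    ∀ r, IsProj A r → (∀ p, IsProj A p → Transient A T p → p ≤ r) → e ≤ r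

end QMP

open QMP

section PositiveOperators

variable {H : Type*} [NormedAddCommGroup H] [InnerProductSpace ℂ H]

theorem ContinuousLinearMap.re_inner_le_of_le {a b : H →L[ℂ] H} (h : a ≤ b) (ξ : H) :
    (inner ℂ (a ξ) ξ).re ≤ (inner ℂ (b ξ) ξ).re := by
  have := ((ContinuousLinearMap.le_def a b).1 h).re_inner_nonneg_left ξ
  simpa [inner_sub_left] using this

open ComplexOrder in
theorem ContinuousLinearMap.nonneg_of_tendsto {f : ℕ → H →L[ℂ] H} {y : H →L[ℂ] H}
    (hf : ∀ᶠ n in atTop, 0 ≤ f n) (hy : ∀ ξ, Tendsto (fun n => f n ξ) atTop (𝓝 (y ξ))) :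
    0 ≤ y := by
  rw [nonneg_iff_isPositive, isPositive_iff_complex]
  intro ξ
  have hlim : Tendsto (fun n => inner ℂ (f n ξ) ξ) atTop (𝓝 (inner ℂ (y ξ) ξ)) :=
    (hy ξ).inner tendsto_const_nhds
  have hmem : inner ℂ (y ξ) ξ ∈ Set.Ici (0 : ℂ) := by
    refine isClosed_Ici.mem_of_tendsto hlim ?_
    filter_upwards [hf] with n hn
    exact ((nonneg_iff_isPositive _).1 hn).inner_nonneg_left ξ
  obtain ⟨h1, h2⟩ := Complex.le_def.1 (Set.mem_Ici.1 hmem)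
  exact ⟨Complex.ext (by simp) (by simpa using h2), by simpa using h1⟩

variable [CompleteSpace H]

theorem ContinuousLinearMap.norm_apply_sq_le_of_nonneg {a : H →L[ℂ] H} (ha : 0 ≤ a) (ξ : H) :
    ‖a ξ‖ ^ 2 ≤ ‖a‖ * (inner ℂ (a ξ) ξ).re := by
  obtain ⟨r, rfl⟩ := CStarAlgebra.nonneg_iff_eq_star_mul_self.1 ha
  have h1 : (inner ℂ ((star r * r) ξ) ξ).re = ‖r ξ‖ ^ 2 := by
    rw [star_eq_adjoint, mul_apply_eq_comp, adjoint_inner_left]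
    exact inner_self_eq_norm_sq (𝕜 := ℂ) (r ξ)
  rw [h1, CStarRing.norm_star_mul_self, mul_apply_eq_comp]
  have h2 : ‖star r (r ξ)‖ ≤ ‖r‖ * ‖r ξ‖ := by
    simpa using (star r).le_opNorm (r ξ)
  calc ‖star r (r ξ)‖ ^ 2 ≤ (‖r‖ * ‖r ξ‖) ^ 2 := by gcongr
    _ = _ := by ring

theorem ContinuousLinearMap.apply_eq_zero_of_re_inner_nonpos {a : H →L[ℂ] H} (ha : 0 ≤ a) {ξ : H}
    (h : (inner ℂ (a ξ) ξ).re ≤ 0) : a ξ = 0 := by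
  have h1 := norm_apply_sq_le_of_nonneg ha ξ
  have h2 : ‖a ξ‖ ^ 2 ≤ 0 := h1.trans (mul_nonpos_of_nonneg_of_nonpos (norm_nonneg _) h)
  simpa using h2

theorem ContinuousLinearMap.apply_eq_zero_of_le {a b : H →L[ℂ] H} (ha : 0 ≤ a) (hab : a ≤ b)
    {ξ : H} (h : b ξ = 0) : a ξ = 0 :=
  apply_eq_zero_of_re_inner_nonpos ha (by simpa [h] using re_inner_le_of_le hab ξ)

theorem IsStarProjection.le_of_forall_apply_eq_zero {p q : H →L[ℂ] H} (hp : IsStarProjection p)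
    (hq : IsStarProjection q) (h : ∀ ξ, q ξ = 0 → p ξ = 0) : p ≤ q := by
  have hpq : p * q = p := by
    ext ξ
    have h1 : q (ξ - q ξ) = 0 := by
      rw [map_sub, sub_eq_zero, ← mul_apply_eq_comp, hq.isIdempotentElem.eq]
    have h2 := h _ h1
    rw [map_sub, sub_eq_zero] at h2
    exact h2.symm
  have hqp : q * p = p := by
    simpa [hp.isSelfAdjoint.star_eq, hq.isSelfAdjoint.star_eq] using congrArg star hpq
  have h3 : 0 ≤ star (q - p) * (q - p) := star_mul_self_nonneg _
  have h4 : star (q - p) * (q - p) = q - p := by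
    rw [star_sub, hp.isSelfAdjoint.star_eq, hq.isSelfAdjoint.star_eq, sub_mul, mul_sub, mul_sub,
      hpq, hqp, hp.isIdempotentElem.eq, hq.isIdempotentElem.eq]
    abel
  rwa [h4, sub_nonneg] at h3

/-- A bounded monotone sequence of positive operators converges strongly. -/
theorem ContinuousLinearMap.exists_tendsto_of_monotone {f : ℕ → H →L[ℂ] H} (hf : Monotone f)
    {b : H →L[ℂ] H} (hb : ∀ n, f n ≤ b) :
    ∃ y : H →L[ℂ] H, ∀ ξ, Tendsto (fun n => f n ξ) atTop (𝓝 (y ξ)) := by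
  have hc : ∀ ξ, CauchySeq fun n => f n ξ := by
    intro ξ
    set g : ℕ → ℝ := fun n => (inner ℂ (f n ξ) ξ).re with hg
    have hgm : Monotone g := fun m n hmn => re_inner_le_of_le (hf hmn) ξ
    have hgb : BddAbove (Set.range g) :=
      ⟨_, Set.forall_mem_range.2 fun n => re_inner_le_of_le (hb n) ξ⟩
    have hgc : CauchySeq g := (tendsto_atTop_ciSup hgm hgb).cauchySeq
    set C := ‖b - f 0‖ + 1 with hC
    have hC0 : 0 < C := by positivity
    have key : ∀ m n, m ≤ n → ‖f n ξ - f m ξ‖ ^ 2 ≤ C * (g n - g m) := by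
      intro m n hmn
      have hD : 0 ≤ f n - f m := sub_nonneg.2 (hf hmn)
      have h1 := norm_apply_sq_le_of_nonneg hD ξ
      have h2 : ‖f n - f m‖ ≤ C := by
        refine (CStarAlgebra.norm_le_norm_of_nonneg_of_le hD
          (sub_le_sub (hb n) (hf (Nat.zero_le m)))).trans ?_
        simp [hC]
      have h3 : (inner ℂ ((f n - f m) ξ) ξ).re = g n - g m := by
        simp [hg]
      rw [h3] at h1
      exact h1.trans (mul_le_mul_of_nonneg_right h2 (sub_nonneg.2 (hgm hmn)))
    rw [Metric.cauchySeq_iff'] at hgc ⊢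
    intro ε hε
    obtain ⟨N, hN⟩ := hgc (ε ^ 2 / C) (by positivity)
    refine ⟨N, fun n hn => ?_⟩
    have h1 := key N n hn
    have h2 := hN n hn
    rw [Real.dist_eq] at h2
    have h3 := (le_abs_self _).trans_lt h2
    rw [lt_div_iff₀ hC0] at h3
    rw [dist_eq_norm]
    exact lt_of_pow_lt_pow_left₀ 2 hε.le (by linarith)
  choose y hy using fun ξ => cauchySeq_tendsto_of_complete (hc ξ)
  exact ⟨continuousLinearMapOfTendsto f (tendsto_pi_nhds.2 hy), hy⟩

theorem ContinuousLinearMap.isLUB_of_tendsto {f : ℕ → H →L[ℂ] H} (hf : Monotone f)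
    {y : H →L[ℂ] H} (hy : ∀ ξ, Tendsto (fun n => f n ξ) atTop (𝓝 (y ξ))) :
    IsLUB (Set.range f) y := by
  constructor
  · rintro _ ⟨n, rfl⟩
    rw [← sub_nonneg]
    refine nonneg_of_tendsto (f := fun m => f m - f n) ?_ fun ξ => ?_
    · filter_upwards [eventually_ge_atTop n] with m hm
      exact sub_nonneg.2 (hf hm)
    · simpa using (hy ξ).sub_const (f n ξ)
  · intro u hu
    rw [← sub_nonneg]
    refine nonneg_of_tendsto (f := fun m => u - f m) (.of_forall fun m => ?_) fun ξ => ?_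
    · exact sub_nonneg.2 (hu ⟨m, rfl⟩)
    · simpa using (hy ξ).const_sub (u ξ)

theorem VonNeumannAlgebra.mem_iff_forall_commutant {A : VonNeumannAlgebra H} {x : H →L[ℂ] H} :
    x ∈ A ↔ ∀ z ∈ A.commutant, z * x = x * z := by
  conv_lhs => rw [← A.commutant_commutant]
  exact mem_commutant_iff

theorem VonNeumannAlgebra.mem_of_tendsto {A : VonNeumannAlgebra H} {f : ℕ → H →L[ℂ] H}
    (hf : ∀ n, f n ∈ A) {y : H →L[ℂ] H}
    (hy : ∀ ξ, Tendsto (fun n => f n ξ) atTop (𝓝 (y ξ))) : y ∈ A := by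
  refine mem_iff_forall_commutant.2 fun z hz => ?_
  ext ξ
  refine tendsto_nhds_unique ((z.continuous.tendsto _).comp (hy ξ)) ?_
  refine (hy (z ξ)).congr fun n => ?_
  exact (congrArg (fun w : H →L[ℂ] H => w ξ) (mem_iff_forall_commutant.1 (hf n) z hz)).symm

/-- The projection onto the closed range of `(y - 1)⁺`: a spectral projection of `y`. -/
theorem VonNeumannAlgebra.exists_isProj_le {A : VonNeumannAlgebra H} {y : H →L[ℂ] H}
    (hyA : y ∈ A) (hy : 0 ≤ y) :
    ∃ q, IsProj A q ∧ q ≤ y ∧ ∀ ξ, q ξ = 0 → (inner ℂ (y ξ) ξ).re ≤ ‖ξ‖ ^ 2 := by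
  have hys : IsSelfAdjoint y := .of_nonneg hy
  have hw : IsSelfAdjoint (y - 1) := hys.sub (.one _)
  set a : H →L[ℂ] H := (y - 1)⁺
  set b : H →L[ℂ] H := (y - 1)⁻
  have hyab : y = 1 + a - b := by
    have := CFC.posPart_sub_negPart (y - 1) hw
    rw [add_sub_assoc, this]; abel
  have hba : b * a = 0 := CFC.negPart_mul_posPart _
  have ha : 0 ≤ a := CFC.posPart_nonneg _
  have hb : 0 ≤ b := CFC.negPart_nonneg _
  have has : IsSelfAdjoint a := .of_nonneg ha
  have hbs : IsSelfAdjoint b := .of_nonneg hb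
  set K : Submodule ℂ H := (LinearMap.range (a : H →ₗ[ℂ] H)).topologicalClosure
  have : CompleteSpace K := (Submodule.isClosed_topologicalClosure _).completeSpace_coe
  set q : H →L[ℂ] H := K.starProjection with hq_def
  have hq : IsStarProjection q := isStarProjection_starProjection
  have hqs := hq.isSelfAdjoint
  have haK : ∀ ξ, a ξ ∈ K := fun ξ => Submodule.le_topologicalClosure _ ⟨ξ, rfl⟩
  have hqa : q * a = a := by
    ext ξ
    exact Submodule.starProjection_eq_self_iff.2 (haK ξ)
  have haq : a * q = a := by
    simpa [hqs.star_eq, has.star_eq] using congrArg star hqa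
  have hbq : b * q = 0 := by
    ext ξ
    have hle : K ≤ LinearMap.ker (b : H →ₗ[ℂ] H) := by
      refine Submodule.topologicalClosure_minimal _ ?_ b.isClosed_ker
      rintro _ ⟨η, rfl⟩
      exact congrArg (fun w : H →L[ℂ] H => w η) hba
    exact hle (Submodule.starProjection_apply_mem K ξ)
  have hqb : q * b = 0 := by
    simpa [hqs.star_eq, hbs.star_eq] using congrArg star hbq
  refine ⟨q, ⟨?_, hqs, hq.isIdempotentElem⟩, ?_, fun ξ hξ => ?_⟩
  · rw [IsStarProjection.mem_iff hq]
    intro z hz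
    have hza : Commute a z := by
      have h1 : Commute (y - 1) z :=
        Commute.sub_left (mem_iff_forall_commutant.1 hyA z hz).symm (Commute.one_left z)
      exact h1.cfcₙ_real _
    rw [Module.End.mem_invtSubmodule, hq_def, Submodule.range_starProjection]
    intro ζ hζ
    have hmaps : Set.MapsTo z (LinearMap.range (a : H →ₗ[ℂ] H) : Set H)
        (LinearMap.range (a : H →ₗ[ℂ] H) : Set H) := by
      rintro _ ⟨η, rfl⟩
      exact ⟨z η, congrArg (fun w : H →L[ℂ] H => w η) hza.eq⟩
    exact hmaps.closure z.continuous hζ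
  · have h1 : y - q = star (1 - q) * y * (1 - q) + a := by
      rw [star_sub, star_one, hqs.star_eq, hyab]
      simp only [sub_mul, mul_sub, add_mul, mul_add, mul_one, one_mul, hqa, haq, hqb, hbq,
        hq.isIdempotentElem.eq]
      abel_nf
      simp
    rw [← sub_nonneg, h1]
    exact add_nonneg (star_left_conjugate_nonneg hy _) ha
  · have haξ : a ξ = 0 := by
      rw [← haq, mul_apply_eq_comp, hξ, map_zero]
    have h1 := re_inner_le_of_le hb ξ
    have h2 : (inner ℂ ξ ξ).re = ‖ξ‖ ^ 2 := inner_self_eq_norm_sq (𝕜 := ℂ) ξ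
    rw [hyab]
    simp only [sub_apply, add_apply, one_apply_eq_self, haξ, add_zero, inner_sub_left,
      Complex.sub_re, h2]
    simp only [zero_apply, inner_zero_left, Complex.zero_re] at h1
    linarith

end PositiveOperators

section Iterates

theorem LinearMap.sum_range_iterate_sub {R M : Type*} [Semiring R] [AddCommGroup M] [Module R M]
    (f : M →ₗ[R] M) (x : M) (N : ℕ) :
    ∑ n ∈ Finset.range N, f^[n] (x - f x) = x - f^[N] x := by
  simp only [iterate_map_sub, ← Function.iterate_succ_apply]
  exact Finset.sum_range_sub' (fun n => f^[n] x) N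

variable {H : Type*} [NormedAddCommGroup H] [InnerProductSpace ℂ H] [CompleteSpace H]
  {A : VonNeumannAlgebra H} {L : (H →L[ℂ] H) →ₗ[ℂ] (H →L[ℂ] H)}

theorem QMP.IsMarkov.monotone (hL : IsMarkov A L) : Monotone L := by
  intro x y hxy
  rw [← sub_nonneg, ← map_sub]
  obtain ⟨r, hr⟩ := CStarAlgebra.nonneg_iff_eq_star_mul_self.1 (sub_nonneg.2 hxy)
  rw [hr]
  simpa using hL.cp 1 (fun _ => r) (fun _ => 1)

theorem QMP.IsMarkov.iterate_mem (hL : IsMarkov A L) {x : H →L[ℂ] H} (hx : x ∈ A) (n : ℕ) :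
    L^[n] x ∈ A := by
  induction n with
  | zero => exact hx
  | succ n ih => rw [Function.iterate_succ_apply']; exact hL.mapsSelf _ ih

theorem QMP.IsMarkov.iterate_nonneg (hL : IsMarkov A L) {x : H →L[ℂ] H} (hx : 0 ≤ x) (n : ℕ) :
    0 ≤ L^[n] x := by
  simpa only [iterate_map_zero] using hL.monotone.iterate n hx

/-- Iterates of a superharmonic positive element converge strongly to a harmonic element. -/
theorem QMP.IsMarkov.exists_tendsto_iterate (hL : IsMarkov A L) {p : H →L[ℂ] H} (hpA : p ∈ A)
    (hp : 0 ≤ p) (hsuper : L p ≤ p) :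
    ∃ y ∈ A, 0 ≤ y ∧ y ≤ p ∧ L y = y ∧ ∀ ξ, Tendsto (fun n => (L^[n] p) ξ) atTop (𝓝 (y ξ)) := by
  have hanti : Antitone fun n => L^[n] p := hL.monotone.antitone_iterate_of_map_le hsuper
  have hmono : Monotone fun n => p - L^[n] p := fun m n h => sub_le_sub_left (hanti h) p
  obtain ⟨w, hw⟩ := exists_tendsto_of_monotone hmono (b := p)
    fun n => sub_le_self p (hL.iterate_nonneg hp n)
  have hlim : ∀ ξ, Tendsto (fun n => (L^[n] p) ξ) atTop (𝓝 ((p - w) ξ)) := fun ξ => by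
    simpa using (hw ξ).const_sub (p ξ)
  have hLw : L w = w - (p - L p) := by
    have hshift : IsLUB (Set.range fun n => L (p - L^[n] p)) (w - (p - L p)) := by
      refine isLUB_of_tendsto (fun m n h => hL.monotone (hmono h)) fun ξ => ?_
      refine (((tendsto_add_atTop_iff_nat 1).2 (hw ξ)).sub_const ((p - L p) ξ)).congr fun n => ?_
      simp [Function.iterate_succ_apply']
    exact (hL.normal _ w hmono (isLUB_of_tendsto hmono hw)).unique hshift
  refine ⟨p - w, VonNeumannAlgebra.mem_of_tendsto (hL.iterate_mem hpA) hlim,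
    nonneg_of_tendsto (.of_forall fun n => hL.iterate_nonneg hp n) hlim, ?_, ?_, hlim⟩
  · refine sub_le_self p (nonneg_of_tendsto (.of_forall fun n => ?_) hw)
    simpa using hmono (Nat.zero_le n)
  · rw [map_sub, hLw]
    abel

/-- A positive element whose iterates have uniformly bounded partial sums is summable. -/
theorem QMP.IsMarkov.tSummable_of_sum_le (hL : IsMarkov A L) {x b : H →L[ℂ] H} (hxA : x ∈ A)
    (hx : 0 ≤ x) (hb : ∀ N, ∑ n ∈ Finset.range N, L^[n] x ≤ b) : TSummable A L x := by
  obtain ⟨y, hy⟩ := exists_tendsto_of_monotone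
    (f := fun N => ∑ n ∈ Finset.range N, L^[n] x)
    (monotone_nat_of_le_succ fun N => by
      rw [Finset.sum_range_succ]
      exact le_add_of_nonneg_right (hL.iterate_nonneg hx N)) hb
  refine ⟨hxA, hx, y, VonNeumannAlgebra.mem_of_tendsto
    (fun N => sum_mem fun n _ => hL.iterate_mem hxA n) hy,
    nonneg_of_tendsto (.of_forall fun N => Finset.sum_nonneg fun n _ =>
      hL.iterate_nonneg hx n) hy, fun η => ?_⟩
  simpa only [sum_apply] using hy η

end Iterates

/-- If `T` is ergodic (`fix T = ℂ·1`), then every superharmonic projection `p` with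
`0 ≠ p ≠ 1` is a potential, and in particular transient. -/
theorem ergodic_superharmonic_projection_transient
    {H : Type*} [NormedAddCommGroup H] [InnerProductSpace ℂ H] [CompleteSpace H]
    (A : VonNeumannAlgebra H) (T : (H →L[ℂ] H) → (H →L[ℂ] H)) (hT : IsMarkov A T)
    (herg : ∀ x ∈ A, T x = x → ∃ c : ℂ, x = c • (1 : H →L[ℂ] H))
    (p : H →L[ℂ] H) (hp : IsProj A p) (hp0 : p ≠ 0) (hp1 : p ≠ 1)
    (hsuper : T p ≤ p) :
    IsPotential A T p ∧ Transient A T p := by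
  obtain ⟨L, rfl⟩ : ∃ L : (H →L[ℂ] H) →ₗ[ℂ] (H →L[ℂ] H), ⇑L = T := ⟨hT.linear.mk' T, rfl⟩
  have hpsp : IsStarProjection p := ⟨hp.2.2, hp.2.1⟩
  have hp_nonneg : 0 ≤ p := hpsp.nonneg
  obtain ⟨y, hyA, hy0, hyp, hyL, hylim⟩ := hT.exists_tendsto_iterate hp.1 hp_nonneg hsuper
  obtain ⟨c, rfl⟩ := herg y hyA hyL
  obtain ⟨ζ, hζ⟩ : ∃ ζ, p ζ ≠ ζ := by
    by_contra! h
    exact hp1 (ContinuousLinearMap.ext h)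
  have hlim : ∀ ξ, Tendsto (fun n => (L^[n] p) ξ) atTop (𝓝 0) := by
    have hker : p (ζ - p ζ) = 0 := by
      rw [map_sub, sub_eq_zero, ← mul_apply_eq_comp, hp.2.2.eq]
    have h0 := apply_eq_zero_of_le hy0 hyp hker
    have hc : c = 0 := by
      simpa [sub_eq_zero, hζ.symm] using h0
    simpa [hc] using hylim
  have hxA : p - L p ∈ A := sub_mem hp.1 (hT.mapsSelf p hp.1)
  have hx : 0 ≤ p - L p := sub_nonneg.2 hsuper
  have hsum : SOTSum L (p - L p) p := fun η => by
    simp only [← sum_apply, L.sum_range_iterate_sub]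
    simpa using (hlim η).const_sub (p η)
  refine ⟨⟨hp.1, hp_nonneg, _, hxA, hx, hsum⟩, ?_⟩
  have hxn : ∀ n, 0 ≤ L^[n] (p - L p) := hT.iterate_nonneg hx
  choose q hqA hqle hqker using fun i : ℕ × ℕ => VonNeumannAlgebra.exists_isProj_le
    (nsmul_mem (hT.iterate_mem hxA i.1) (i.2 + 1)) (nsmul_nonneg (hxn i.1) (i.2 + 1))
  have hq0 : ∀ i, 0 ≤ q i := fun i =>
    IsStarProjection.nonneg ⟨(hqA i).2.2, (hqA i).2.1⟩
  refine ⟨ℕ × ℕ, q, p, fun i => ⟨hqA i, ?_⟩, ⟨hp, fun i => ?_, fun r hr hqr => ?_⟩, le_rfl⟩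
  · refine hT.tSummable_of_sum_le (hqA i).1 (hq0 i) (b := (i.2 + 1) • L^[i.1] p) fun N => ?_
    calc ∑ n ∈ Finset.range N, L^[n] (q i)
        ≤ ∑ n ∈ Finset.range N, (i.2 + 1) • L^[n] (L^[i.1] p - L (L^[i.1] p)) := by
          refine Finset.sum_le_sum fun n _ => ?_
          rw [← iterate_map_nsmul]
          refine hT.monotone.iterate n ((hqle i).trans_eq ?_)
          rw [iterate_map_sub, ← Function.iterate_succ_apply, Function.iterate_succ_apply']
      _ = (i.2 + 1) • (L^[i.1] p - L^[N] (L^[i.1] p)) := by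
          rw [← Finset.smul_sum, L.sum_range_iterate_sub]
      _ ≤ (i.2 + 1) • L^[i.1] p := nsmul_le_nsmul_right (sub_le_self _
          (hT.iterate_nonneg (hT.iterate_nonneg hp_nonneg _) _)) _
  · refine IsStarProjection.le_of_forall_apply_eq_zero ⟨(hqA i).2.2, (hqA i).2.1⟩ hpsp
      fun ξ hξ => ?_
    have hle : L^[i.1] (p - L p) ≤ p := by
      rw [iterate_map_sub, ← Function.iterate_succ_apply]
      exact (sub_le_self _ (hT.iterate_nonneg hp_nonneg _)).trans
        (hT.monotone.antitone_iterate_of_map_le hsuper (Nat.zero_le i.1))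
    have hzero := apply_eq_zero_of_le (hxn i.1) hle hξ
    refine apply_eq_zero_of_le (hq0 i) (hqle i) ?_
    rw [smul_apply, hzero, smul_zero]
  · refine hpsp.le_of_forall_apply_eq_zero ⟨hr.2.2, hr.2.1⟩ fun ξ hξ => ?_
    have hzero : ∀ n, (L^[n] (p - L p)) ξ = 0 := by
      intro n
      refine apply_eq_zero_of_re_inner_nonpos (hxn n) ?_
      refine le_of_tendsto_of_tendsto' tendsto_const_nhds
        (tendsto_const_div_atTop_nhds_zero_nat (‖ξ‖ ^ 2) |>.comp (tendsto_add_atTop_nat 1))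
        fun k => ?_
      have h1 := hqker (n, k) ξ (apply_eq_zero_of_le (hq0 _) (hqr _) hξ)
      rw [← Nat.cast_smul_eq_nsmul ℂ] at h1
      simp only [smul_apply, inner_smul_left] at h1
      rw [Function.comp_apply, le_div_iff₀ (by positivity), mul_comm]
      simpa [-iterate_map_sub, -map_sub, -sub_apply] using h1
    refine tendsto_nhds_unique (hsum ξ) ?_
    simp only [hzero, Finset.sum_const_zero, tendsto_const_nhds_iff]
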